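/- arXiv:2205.04589 — 8 statements merged into one kernel-verified Lean document; each statement's English description precedes it below -/
import Mathlib

section
/- Let C : ℝ³ → Matrix (Fin 3) (Fin 3) ℝ be any map such that C(v) is skew-symmetric for every v ∈ ℝ³, let D be a 3×3 real matrix, and let G be the 3×2 real matrix with rows (1,0), (0,0), (0,1). Suppose v* ∈ ℝ³ and u* ∈ ℝ² satisfy the steady-state relation C(v*)v* + D v* = G u*. Define 𝒥(w) := C(w)v* + D w for w ∈ ℝ³. Then for all v ∈ ℝ³ and u ∈ ℝ², (v − v*)ᵀ (G u − C(v)v − D v) = (Gᵀv − Gᵀv*)ᵀ (u − u*) − (v − v*)ᵀ (𝒥(v) − 𝒥(v*)). -/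
open Matrix

/-- The quadratic form of a skew-symmetric real matrix vanishes. -/
theorem dotProduct_mulVec_self_eq_zero_of_transpose_eq_neg {n : Type*} [Fintype n]
    {A : Matrix n n ℝ} (hA : Aᵀ = -A) (x : n → ℝ) : x ⬝ᵥ (A *ᵥ x) = 0 := by
  have h : x ⬝ᵥ (A *ᵥ x) = -(x ⬝ᵥ (A *ᵥ x)) := by
    conv_lhs => rw [dotProduct_mulVec, ← mulVec_transpose, hA, neg_mulVec, neg_dotProduct,
      dotProduct_comm]
  linarith

/-- Energy-rate identity used in the proof of shifted passivity (Proposition 1). -/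
theorem stmt0
    (C : (Fin 3 → ℝ) → Matrix (Fin 3) (Fin 3) ℝ)
    (hC : ∀ v, (C v)ᵀ = -(C v))
    (D : Matrix (Fin 3) (Fin 3) ℝ)
    (G : Matrix (Fin 3) (Fin 2) ℝ)
    (hG : G = !![1, 0; 0, 0; 0, 1])
    (vstar : Fin 3 → ℝ) (ustar : Fin 2 → ℝ)
    (hss : C vstar *ᵥ vstar + D *ᵥ vstar = G *ᵥ ustar)
    (𝒥 : (Fin 3 → ℝ) → (Fin 3 → ℝ))
    (h𝒥 : ∀ w, 𝒥 w = C w *ᵥ vstar + D *ᵥ w) :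
    ∀ (v : Fin 3 → ℝ) (u : Fin 2 → ℝ),
      (v - vstar) ⬝ᵥ (G *ᵥ u - C v *ᵥ v - D *ᵥ v)
        = (Gᵀ *ᵥ v - Gᵀ *ᵥ vstar) ⬝ᵥ (u - ustar)
          - (v - vstar) ⬝ᵥ (𝒥 v - 𝒥 vstar) := by
  intro v u
  have hsplit : G *ᵥ u - C v *ᵥ v - D *ᵥ v
      = G *ᵥ (u - ustar) - C v *ᵥ (v - vstar) - (𝒥 v - 𝒥 vstar) := by
    rw [h𝒥, h𝒥, hss, mulVec_sub, mulVec_sub]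
    abel
  rw [hsplit, dotProduct_sub, dotProduct_sub,
    dotProduct_mulVec_self_eq_zero_of_transpose_eq_neg (hC v), sub_zero, dotProduct_mulVec,
    ← mulVec_transpose, mulVec_sub]
end

section
/- Consider the boat model with M = diag(m₁₁,m₂₂,m₃₃), D = diag(d₁₁,d₂₂,d₃₃) (all diagonal entries positive), G the 3×2 matrix with rows (1,0),(0,0),(0,1), and Coriolis matrix C(v) = [[0,0,−m₂₂v_y],[0,0,m₁₁v_x],[m₂₂v_y,−m₁₁v_x,0]] for v = (v_x,v_y,ω). Let c > 0 satisfy c·|m₂₂ − m₁₁| ≤ 2·√(d₁₁·d₂₂)·d₃₃, and set u* := (0,c) ∈ ℝ² and v* := (0,0,c/d₃₃) ∈ ℝ³. Then the system is shifted passive: for all v ∈ ℝ³ and u ∈ ℝ², (v − v*)ᵀ (G u − C(v)v − D v) ≤ (Gᵀv − Gᵀv*)ᵀ (u − u*). Equivalently, with storage function H(v) = ½(v − v*)ᵀ M (v − v*), the rate ∇H(v)ᵀ M⁻¹(Gu − C(v)v − Dv) is bounded above by (Gᵀv − Gᵀv*)ᵀ(u − u*). -/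
open Matrix

/-- A binary quadratic form with nonnegative diagonal dominates its cross term `k * x * y`
whenever `|k| ≤ 2 * √(a * b)`. -/
lemma mul_mul_le_of_abs_le_two_mul_sqrt {a b k : ℝ} (ha : 0 ≤ a) (hb : 0 ≤ b)
    (hk : |k| ≤ 2 * Real.sqrt (a * b)) (x y : ℝ) :
    k * x * y ≤ a * x ^ 2 + b * y ^ 2 := by
  rw [Real.sqrt_mul ha] at hk
  calc k * x * y ≤ |k| * (|x| * |y|) := by
        rw [← abs_mul, ← abs_mul, ← mul_assoc]; exact le_abs_self _
    _ ≤ 2 * (√a * √b) * (|x| * |y|) := by gcongr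
    _ = 2 * (√a * |x|) * (√b * |y|) := by ring
    _ ≤ (√a * |x|) ^ 2 + (√b * |y|) ^ 2 := two_mul_le_add_sq _ _
    _ = a * x ^ 2 + b * y ^ 2 := by
        rw [mul_pow, mul_pow, Real.sq_sqrt ha, Real.sq_sqrt hb, sq_abs, sq_abs]

/-- Shifted passivity of the boat model under the explicit bound
`c·|m₂₂ − m₁₁| ≤ 2·√(d₁₁·d₂₂)·d₃₃` (Proposition 1 combined with Section V). -/
theorem stmt2
    (m₁₁ m₂₂ m₃₃ d₁₁ d₂₂ d₃₃ c : ℝ)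
    (hm₁₁ : 0 < m₁₁) (hm₂₂ : 0 < m₂₂) (hm₃₃ : 0 < m₃₃)
    (hd₁₁ : 0 < d₁₁) (hd₂₂ : 0 < d₂₂) (hd₃₃ : 0 < d₃₃)
    (hc : 0 < c)
    (hbound : c * |m₂₂ - m₁₁| ≤ 2 * Real.sqrt (d₁₁ * d₂₂) * d₃₃)
    (M D : Matrix (Fin 3) (Fin 3) ℝ)
    (hM : M = Matrix.diagonal ![m₁₁, m₂₂, m₃₃])
    (hD : D = Matrix.diagonal ![d₁₁, d₂₂, d₃₃])
    (G : Matrix (Fin 3) (Fin 2) ℝ)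
    (hG : G = !![1, 0; 0, 0; 0, 1])
    (C : (Fin 3 → ℝ) → Matrix (Fin 3) (Fin 3) ℝ)
    (hCdef : ∀ v, C v = !![0, 0, -(m₂₂ * v 1);
                           0, 0, m₁₁ * v 0;
                           m₂₂ * v 1, -(m₁₁ * v 0), 0])
    (ustar : Fin 2 → ℝ) (hustar : ustar = ![0, c])
    (vstar : Fin 3 → ℝ) (hvstar : vstar = ![0, 0, c / d₃₃]) :
    ∀ (v : Fin 3 → ℝ) (u : Fin 2 → ℝ),
      (v - vstar) ⬝ᵥ (G *ᵥ u - C v *ᵥ v - D *ᵥ v)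
        ≤ (Gᵀ *ᵥ v - Gᵀ *ᵥ vstar) ⬝ᵥ (u - ustar) := by
  intro v u
  subst hD hG hustar hvstar
  set s := c / d₃₃ with hs
  have hcs : c = d₃₃ * s := by rw [hs]; field_simp
  have hk : |s * (m₂₂ - m₁₁)| ≤ 2 * Real.sqrt (d₁₁ * d₂₂) := by
    rw [abs_mul, abs_of_pos (div_pos hc hd₃₃), div_mul_eq_mul_div, div_le_iff₀ hd₃₃]
    exact hbound
  have hcross := mul_mul_le_of_abs_le_two_mul_sqrt hd₁₁.le hd₂₂.le hk (v 0) (v 1)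
  have hyaw : 0 ≤ d₃₃ * (v 2 - s) ^ 2 := by positivity
  simp [hCdef, Matrix.mulVec, dotProduct, Fin.sum_univ_succ, Matrix.diagonal_apply]
  rw [hcs]
  linarith
end

section
/- Let m₁₁, m₂₂ ∈ ℝ, let d₁₁, d₂₂, d₃₃ > 0, let D = diag(d₁₁,d₂₂,d₃₃), let ω* ∈ ℝ, and let S(ω*) be the symmetric 3×3 matrix [[0,(m₁₁−m₂₂)ω*,0],[(m₁₁−m₂₂)ω*,0,0],[0,0,0]] (the symmetrization A + Aᵀ of the Jacobian A of v ↦ C(v)v* at any v, where C(v) = [[0,0,−m₂₂v_y],[0,0,m₁₁v_x],[m₂₂v_y,−m₁₁v_x,0]] and v* = (0,0,ω*)). Then 2D − S(ω*) is positive semidefinite if and only if 4·d₁₁·d₂₂ − (ω*)²·(m₁₁ − m₂₂)² ≥ 0. -/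
open Matrix

/-- The matrix inequality `2D − S(ω*) ⪰ 0` characterizing shifted passivity of the
boat model holds iff `4·d₁₁·d₂₂ − (ω*)²·(m₁₁ − m₂₂)² ≥ 0` (Section V). -/
theorem stmt3
    (m₁₁ m₂₂ d₁₁ d₂₂ d₃₃ ωstar : ℝ)
    (hd₁₁ : 0 < d₁₁) (hd₂₂ : 0 < d₂₂) (hd₃₃ : 0 < d₃₃)
    (D : Matrix (Fin 3) (Fin 3) ℝ)
    (hD : D = Matrix.diagonal ![d₁₁, d₂₂, d₃₃])
    (S : Matrix (Fin 3) (Fin 3) ℝ)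
    (hS : S = !![0, (m₁₁ - m₂₂) * ωstar, 0;
                 (m₁₁ - m₂₂) * ωstar, 0, 0;
                 0, 0, 0]) :
    (∀ h : Fin 3 → ℝ, 0 ≤ h ⬝ᵥ (((2 : ℝ) • D - S) *ᵥ h)) ↔
      0 ≤ 4 * d₁₁ * d₂₂ - ωstar ^ 2 * (m₁₁ - m₂₂) ^ 2 := by
  have key : ∀ h : Fin 3 → ℝ, h ⬝ᵥ (((2 : ℝ) • D - S) *ᵥ h) =
      2 * (d₁₁ * h 0 ^ 2 + d₂₂ * h 1 ^ 2 + d₃₃ * h 2 ^ 2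
        - (m₁₁ - m₂₂) * ωstar * h 0 * h 1) := by
    intro h
    subst hD hS
    simp [dotProduct, mulVec, Fin.sum_univ_three, Matrix.diagonal_apply]
    ring
  simp only [key]
  constructor
  · intro H
    have h := H ![(m₁₁ - m₂₂) * ωstar, 2 * d₁₁, 0]
    simp only [cons_val] at h
    refine nonneg_of_mul_nonneg_right (a := 2 * d₁₁) ?_ (by positivity)
    linear_combination h
  · intro H h
    refine nonneg_of_mul_nonneg_right (a := 2 * d₁₁) ?_ (by positivity)
    have square : 0 ≤ (2 * d₁₁ * h 0 - (m₁₁ - m₂₂) * ωstar * h 1) ^ 2 := sq_nonneg _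
    have rest := mul_nonneg H (sq_nonneg (h 1))
    have third : 0 ≤ 4 * d₁₁ * d₃₃ * h 2 ^ 2 := by positivity
    linear_combination square + rest + third
end

section
/- Consider the interconnected system ẋ₁ = f₁(x₁,x₂), ẋ₂ = f₂(x₁,x₂) on ℝ^{n₁} × ℝ^{n₂} with f₁, f₂ continuous. Suppose there exist a C¹ function V : ℝ^{n₁} × ℝ^{n₂} → ℝ, class-K∞ functions α₁, α₂, and a continuous positive definite function α₃ : [0,∞) → [0,∞) (i.e. α₃(0) = 0 and α₃(s) > 0 for s > 0) such that α₁(|x₁|) ≤ V(x₁,x₂) ≤ α₂(|x₁|) and ⟨∇V(x₁,x₂), (f₁(x₁,x₂), f₂(x₁,x₂))⟩ ≤ −α₃(|x₁|) for all (x₁,x₂). Then the system is uniformly globally attractive with respect to x₁ uniformly in x₂(0): for every r > 0 and every σ > 0 there exists T = T(r,σ) > 0 such that every solution (x₁,x₂) : [0,∞) → ℝ^{n₁} × ℝ^{n₂} with |x₁(0)| ≤ r satisfies |x₁(t)| ≤ σ for all t ≥ T, regardless of x₂(0). -/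
/-- A function of class K∞ on [0,∞). -/
def IsClassKInfty (α : ℝ → ℝ) : Prop :=
  ContinuousOn α (Set.Ici 0) ∧ StrictMonoOn α (Set.Ici 0) ∧ α 0 = 0 ∧
    Filter.Tendsto α Filter.atTop Filter.atTop

/-- A function whose derivative is at most `C` on `[a, b]` grows by at most `C * (b - a)`. -/
lemma sub_le_mul_sub_of_hasDerivAt_le {v v' : ℝ → ℝ} {a b C : ℝ} (hab : a ≤ b)
    (hv : ∀ t ∈ Set.Icc a b, HasDerivAt v (v' t) t) (hC : ∀ t ∈ Set.Icc a b, v' t ≤ C) :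
    v b - v a ≤ C * (b - a) := by
  refine (convex_Icc a b).image_sub_le_mul_sub_of_deriv_le
    (fun t ht => (hv t ht).continuousAt.continuousWithinAt)
    (fun t ht => (hv t (interior_subset ht)).differentiableAt.differentiableWithinAt)
    (fun t ht => ?_) a (Set.left_mem_Icc.2 hab) b (Set.right_mem_Icc.2 hab) hab
  rw [(hv t (interior_subset ht)).deriv]
  exact hC t (interior_subset ht)

namespace IsClassKInfty

variable {α : ℝ → ℝ}

lemma nonneg (hα : IsClassKInfty α) {s : ℝ} (hs : 0 ≤ s) : 0 ≤ α s := by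
  have := hα.2.1.monotoneOn (Set.mem_Ici.2 le_rfl) (Set.mem_Ici.2 hs) hs
  rwa [hα.2.2.1] at this

lemma pos (hα : IsClassKInfty α) {s : ℝ} (hs : 0 < s) : 0 < α s := by
  have := hα.2.1 (Set.mem_Ici.2 le_rfl) (Set.mem_Ici.2 hs.le) hs
  rwa [hα.2.2.1] at this

lemma mono (hα : IsClassKInfty α) {s t : ℝ} (hs : 0 ≤ s) (hst : s ≤ t) : α s ≤ α t :=
  hα.2.1.monotoneOn (Set.mem_Ici.2 hs) (Set.mem_Ici.2 (hs.trans hst)) hst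

lemma le_of_le (hα : IsClassKInfty α) {s t : ℝ} (hs : 0 ≤ s) (ht : 0 ≤ t) (h : α s ≤ α t) :
    s ≤ t :=
  (hα.2.1.le_iff_le (Set.mem_Ici.2 hs) (Set.mem_Ici.2 ht)).1 h

lemma exists_pos_le (hα : IsClassKInfty α) {ε : ℝ} (hε : 0 < ε) : ∃ δ > 0, α δ ≤ ε := by
  have hlim : Filter.Tendsto α (nhdsWithin 0 (Set.Ioi 0)) (nhds 0) := by
    have h := (hα.1 0 (Set.mem_Ici.2 le_rfl)).mono Set.Ioi_subset_Ici_self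
    rwa [ContinuousWithinAt, hα.2.2.1] at h
  obtain ⟨δ, hδε, hδ⟩ := ((hlim.eventually_lt_const hε).and self_mem_nhdsWithin).exists
  exact ⟨δ, hδ, hδε.le⟩

lemma exists_pos_ge (hα : IsClassKInfty α) (M : ℝ) : ∃ R > 0, M ≤ α R := by
  obtain ⟨R, hM, hR⟩ :=
    ((hα.2.2.2.eventually_ge_atTop M).and (Filter.eventually_gt_atTop 0)).exists
  exact ⟨R, hR, hM⟩

end IsClassKInfty

/-- A continuous function that is positive on `(0, ∞)` is bounded below by a positive constant on
every compact interval `[δ, R]` with `0 < δ`. -/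
lemma exists_pos_forall_mem_Icc_le {α : ℝ → ℝ} (hcont : Continuous α)
    (hpos : ∀ s : ℝ, 0 < s → 0 < α s) {δ : ℝ} (hδ : 0 < δ) (R : ℝ) :
    ∃ c > 0, ∀ s ∈ Set.Icc δ R, c ≤ α s := by
  rcases (Set.Icc δ R).eq_empty_or_nonempty with he | hne
  · exact ⟨1, one_pos, by simp [he]⟩
  · obtain ⟨m, hm, hmin⟩ := isCompact_Icc.exists_isMinOn hne hcont.continuousOn
    exact ⟨α m, hpos m (hδ.trans_le hm.1), fun s hs => hmin hs⟩

/-- P-UGA conclusion of Theorem 1 (second part): strict Lyapunov conditions imply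
uniform global attractivity with respect to `x₁` uniformly in `x₂(0)`. -/
theorem stmt6 {n₁ n₂ : ℕ}
    (f₁ : EuclideanSpace ℝ (Fin n₁) × EuclideanSpace ℝ (Fin n₂) → EuclideanSpace ℝ (Fin n₁))
    (f₂ : EuclideanSpace ℝ (Fin n₁) × EuclideanSpace ℝ (Fin n₂) → EuclideanSpace ℝ (Fin n₂))
    (hf₁ : Continuous f₁) (hf₂ : Continuous f₂)
    (V : EuclideanSpace ℝ (Fin n₁) × EuclideanSpace ℝ (Fin n₂) → ℝ)
    (hV : ContDiff ℝ 1 V)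
    (α₁ α₂ : ℝ → ℝ)
    (hα₁ : IsClassKInfty α₁) (hα₂ : IsClassKInfty α₂)
    (α₃ : ℝ → ℝ) (hα₃cont : Continuous α₃) (hα₃zero : α₃ 0 = 0)
    (hα₃pos : ∀ s : ℝ, 0 < s → 0 < α₃ s)
    (hlow : ∀ p : EuclideanSpace ℝ (Fin n₁) × EuclideanSpace ℝ (Fin n₂), α₁ ‖p.1‖ ≤ V p)
    (hup : ∀ p : EuclideanSpace ℝ (Fin n₁) × EuclideanSpace ℝ (Fin n₂), V p ≤ α₂ ‖p.1‖)
    (hdecr : ∀ p : EuclideanSpace ℝ (Fin n₁) × EuclideanSpace ℝ (Fin n₂),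
      fderiv ℝ V p (f₁ p, f₂ p) ≤ -α₃ ‖p.1‖) :
    ∀ r > 0, ∀ σ > 0, ∃ T > 0,
      ∀ (x₁ : ℝ → EuclideanSpace ℝ (Fin n₁)) (x₂ : ℝ → EuclideanSpace ℝ (Fin n₂)),
        (∀ t, 0 ≤ t → HasDerivAt x₁ (f₁ (x₁ t, x₂ t)) t) →
        (∀ t, 0 ≤ t → HasDerivAt x₂ (f₂ (x₁ t, x₂ t)) t) →
        ‖x₁ 0‖ ≤ r → ∀ t, T ≤ t → ‖x₁ t‖ ≤ σ := by
  intro r hr σ hσ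
  obtain ⟨R, hR, hrR⟩ := hα₁.exists_pos_ge (α₂ r)
  obtain ⟨δ, hδ, hδσ⟩ := hα₂.exists_pos_le (hα₁.pos hσ)
  obtain ⟨c, hc, hcle⟩ := exists_pos_forall_mem_Icc_le hα₃cont hα₃pos hδ R
  have hα₃nonneg : ∀ s, 0 ≤ s → 0 ≤ α₃ s := fun s hs =>
    hs.eq_or_lt.elim (fun h => by rw [← h, hα₃zero]) fun h => (hα₃pos s h).le
  have hdiv : 0 ≤ α₂ r / c := div_nonneg (hα₂.nonneg hr.le) hc.le
  have hT : 0 < α₂ r / c + 1 := by linarith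
  refine ⟨α₂ r / c + 1, hT, fun x₁ x₂ hx₁ hx₂ hx0 t ht => ?_⟩
  have hderiv : ∀ s, 0 ≤ s → HasDerivAt (fun s => V (x₁ s, x₂ s))
      (fderiv ℝ V (x₁ s, x₂ s) (f₁ (x₁ s, x₂ s), f₂ (x₁ s, x₂ s))) s := fun s hs =>
    (hV.differentiable one_ne_zero (x₁ s, x₂ s)).hasFDerivAt.comp_hasDerivAt s
      ((hx₁ s hs).prodMk (hx₂ s hs))
  have hanti : ∀ a b, 0 ≤ a → a ≤ b → V (x₁ b, x₂ b) ≤ V (x₁ a, x₂ a) := fun a b ha hab => by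
    have h := sub_le_mul_sub_of_hasDerivAt_le (C := 0) hab
      (fun s hs => hderiv s (ha.trans hs.1))
      (fun s _ => (hdecr _).trans (neg_nonpos.2 (hα₃nonneg _ (norm_nonneg _))))
    linarith
  have hinit : V (x₁ 0, x₂ 0) ≤ α₂ r := (hup _).trans (hα₂.mono (norm_nonneg _) hx0)
  have hbdd : ∀ s, 0 ≤ s → ‖x₁ s‖ ≤ R := fun s hs =>
    hα₁.le_of_le (norm_nonneg _) hR.le <|
      (hlow (x₁ s, x₂ s)).trans <| (hanti 0 s le_rfl hs).trans <| hinit.trans hrR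
  obtain ⟨s, hs, hsδ⟩ : ∃ s ∈ Set.Icc 0 (α₂ r / c + 1), ‖x₁ s‖ ≤ δ := by
    by_contra! hfar
    have h := sub_le_mul_sub_of_hasDerivAt_le (C := -c) hT.le
      (fun s hs => hderiv s hs.1)
      (fun s hs => (hdecr _).trans (neg_le_neg (hcle _ ⟨(hfar s hs).le, hbdd s hs.1⟩)))
    have hnonneg := (hα₁.nonneg (norm_nonneg _)).trans
      (hlow (x₁ (α₂ r / c + 1), x₂ (α₂ r / c + 1)))
    have hmul : -c * (α₂ r / c + 1 - 0) = -α₂ r - c := by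
      field_simp
      ring
    linarith
  exact hα₁.le_of_le (norm_nonneg _) hσ.le <|
    (hlow (x₁ t, x₂ t)).trans <| (hanti s t hs.1 (hs.2.trans ht)).trans <|
      (hup _).trans <| (hα₂.mono (norm_nonneg _) hsδ).trans hδσ
end

section
/- On ℝ², let f(ξ₁,ξ₂) = (ξ₂, −ξ₂), let k₁,…,k_m : ℝ → ℝ be C², let c₁,…,c_m, e₁,…,e_m ∈ ℝ, let g(ξ₁,ξ₂) = Σ_{i=1}^m c_i·(0, k_i(ξ₁)) and ĝ(ξ₁,ξ₂) = Σ_{j=1}^m e_j·(0, k_j(ξ₁)). Then the iterated Lie bracket satisfies [ĝ, [g, f]](ξ₁,ξ₂) = −Σ_{i=1}^m Σ_{j=1}^m c_i·e_j·(0, (k_i·k_j)'(ξ₁)) for all (ξ₁,ξ₂) ∈ ℝ², where (k_i·k_j)' = k_i'·k_j + k_i·k_j'. -/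
/-- Lie bracket of vector fields: `[V,W](x) = DW(x)·V(x) − DV(x)·W(x)`. -/
noncomputable def lieBracketVF {E : Type*} [NormedAddCommGroup E] [NormedSpace ℝ E]
    (V W : E → E) : E → E :=
  fun x => fderiv ℝ W x (V x) - fderiv ℝ V x (W x)

theorem fderiv_vertical {K : ℝ → ℝ} (hK : Differentiable ℝ K) (p v : ℝ × ℝ) :
    fderiv ℝ (fun p : ℝ × ℝ => ((0 : ℝ), K p.1)) p v = (0, deriv K p.1 * v.1) := by
  have h := (hasFDerivAt_const (0 : ℝ) p).prodMk
    ((hK p.1).hasDerivAt.comp_hasFDerivAt p (hasFDerivAt_fst (𝕜 := ℝ) (p := p)))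
  rw [HasFDerivAt.fderiv (f := fun p : ℝ × ℝ => ((0 : ℝ), K p.1)) h]
  simp

theorem lieBracketVF_vertical_drift {G : ℝ → ℝ} (hG : Differentiable ℝ G) :
    lieBracketVF (fun p : ℝ × ℝ => ((0 : ℝ), G p.1)) (fun p => (p.2, -p.2)) =
      fun p => (G p.1, -G p.1 - deriv G p.1 * p.2) := by
  funext p
  have h := (hasFDerivAt_snd (𝕜 := ℝ) (p := p)).prodMk (hasFDerivAt_snd (𝕜 := ℝ) (p := p)).neg
  rw [lieBracketVF, fderiv_vertical hG,
    HasFDerivAt.fderiv (f := fun p : ℝ × ℝ => (p.2, -p.2)) h]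
  simp

theorem lieBracketVF_vertical_vertical_drift {G H : ℝ → ℝ} (hG : ContDiff ℝ 2 G)
    (hH : Differentiable ℝ H) (p : ℝ × ℝ) :
    lieBracketVF (fun p : ℝ × ℝ => ((0 : ℝ), H p.1))
        (lieBracketVF (fun p : ℝ × ℝ => ((0 : ℝ), G p.1)) (fun p => (p.2, -p.2))) p =
      -((0 : ℝ), deriv (fun x => G x * H x) p.1) := by
  have hG1 : Differentiable ℝ G := hG.differentiable two_ne_zero
  have hG2 : Differentiable ℝ (deriv G) :=
    ((contDiff_succ_iff_deriv (n := 1)).1 hG).2.2.differentiable one_ne_zero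
  have hfst := hasFDerivAt_fst (𝕜 := ℝ) (p := p)
  have hGp := (hG1 p.1).hasDerivAt.comp_hasFDerivAt p hfst
  have h := hGp.prodMk (hGp.neg.sub
    (((hG2 p.1).hasDerivAt.comp_hasFDerivAt p hfst).mul (hasFDerivAt_snd (𝕜 := ℝ) (p := p))))
  rw [lieBracketVF_vertical_drift hG1, lieBracketVF, fderiv_vertical hH,
    HasFDerivAt.fderiv (f := fun p : ℝ × ℝ => (G p.1, -G p.1 - deriv G p.1 * p.2)) h,
    deriv_fun_mul (hG1 p.1) (hH p.1)]
  ext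
  · simp
  · simp
    ring

theorem sum_smul_vertical {ι : Type*} (s : Finset ι) (a b : ι → ℝ) :
    ∑ i ∈ s, a i • ((0 : ℝ), b i) = (0, ∑ i ∈ s, a i * b i) := by
  ext <;> simp [Prod.fst_sum, Prod.snd_sum]

/-- Second-order bracket computation (equation (20)) for the damped
double-integrator example. -/
theorem stmt9 {m : ℕ}
    (k : Fin m → ℝ → ℝ) (hk : ∀ i, ContDiff ℝ 2 (k i))
    (c e : Fin m → ℝ)
    (f g ghat : ℝ × ℝ → ℝ × ℝ)
    (hf : f = fun p => (p.2, -p.2))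
    (hg : g = fun p => ∑ i, c i • ((0 : ℝ), k i p.1))
    (hghat : ghat = fun p => ∑ j, e j • ((0 : ℝ), k j p.1)) :
    ∀ p : ℝ × ℝ,
      lieBracketVF ghat (lieBracketVF g f) p
        = -∑ i, ∑ j, (c i * e j) •
            ((0 : ℝ), deriv (fun x => k i x * k j x) p.1) := by
  intro p
  have hd : ∀ i, Differentiable ℝ (k i) := fun i => (hk i).differentiable two_ne_zero
  have hsum : ∀ a : Fin m → ℝ, ContDiff ℝ 2 (fun x => ∑ i, a i * k i x) := fun a =>
    ContDiff.sum fun i _ => contDiff_const.mul (hk i)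
  simp only [sum_smul_vertical] at hg hghat
  rw [hf, hg, hghat, lieBracketVF_vertical_vertical_drift (hsum c)
    ((hsum e).differentiable two_ne_zero)]
  simp only [sum_smul_vertical]
  have hprod : (fun x => (∑ i, c i * k i x) * ∑ j, e j * k j x) =
      fun x => ∑ i, ∑ j, (c i * e j) * (k i x * k j x) := by
    funext x
    rw [Finset.sum_mul_sum]
    exact Finset.sum_congr rfl fun i _ => Finset.sum_congr rfl fun j _ => by ring
  have hderiv : deriv (fun x => ∑ i, ∑ j, (c i * e j) * (k i x * k j x)) p.1 =
      ∑ i, ∑ j, (c i * e j) * deriv (fun x => k i x * k j x) p.1 :=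
    (HasDerivAt.fun_sum fun i _ => HasDerivAt.fun_sum fun j _ =>
      ((hd i p.1).fun_mul (hd j p.1)).hasDerivAt.const_mul (c i * e j)).deriv
  rw [hprod, hderiv]
  ext <;> simp [Prod.fst_sum, Prod.snd_sum]
end

section
/- Let ρ : ℝ² → ℝ be C¹, let k > 0 and m₁₁, m₂₂, m₃₃, d₁₁, d₂₂, d₃₃ > 0, and let B₁ : ℝ³ → ℝ³ be defined by B₁(x,y,θ) := ( (k/m₁₁)·ρ(x,y), 0, 0 ). Let J(q) = [[cos θ, −sin θ, 0],[sin θ, cos θ, 0],[0,0,1]] for q = (x,y,θ), and let f₂(v) := −M⁻¹( C(v)v + D v − B₀ ) with M = diag(m₁₁,m₂₂,m₃₃), D = diag(d₁₁,d₂₂,d₃₃), C(v) = [[0,0,−m₂₂v_y],[0,0,m₁₁v_x],[m₂₂v_y,−m₁₁v_x,0]] for v = (v_x,v_y,ω), and any fixed B₀ ∈ ℝ³. Then: (a) D²f₂(v)[B₁(q), B₁(q)] = 0 for all v ∈ ℝ³ and q ∈ ℝ³; and (b) the symmetric product satisfies ⟨B₁ : B₁⟩(q) = 2·(k/m₁₁)²·ρ(x,y)·(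 ρ_x(x,y)·cos θ + ρ_y(x,y)·sin θ )·(1,0,0), where ρ_x, ρ_y denote the partial derivatives of ρ. -/
open Matrix

/-- Kinematic transformation matrix of the planar vehicle. -/
noncomputable def Jmat (q : Fin 3 → ℝ) : Matrix (Fin 3) (Fin 3) ℝ :=
  !![Real.cos (q 2), -Real.sin (q 2), 0;
     Real.sin (q 2), Real.cos (q 2), 0;
     0, 0, 1]

/-- The second derivative of a `C²` map vanishes on `(w, w)` if the map is affine along the line
through the base point in direction `w`. -/
theorem fderiv_fderiv_apply_self_eq_zero_of_affine {E F : Type*}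
    [NormedAddCommGroup E] [NormedSpace ℝ E] [NormedAddCommGroup F] [NormedSpace ℝ F]
    {f : E → F} (hf : ContDiff ℝ 2 f) {v w : E} {a : F}
    (h : ∀ t : ℝ, f (v + t • w) = f v + t • a) :
    fderiv ℝ (fderiv ℝ f) v w w = 0 := by
  have hline (s : ℝ) : HasDerivAt (fun t : ℝ => v + t • w) w s := by
    simpa using ((hasDerivAt_id s).smul_const w).const_add v
  have hfirst (s : ℝ) : fderiv ℝ f (v + s • w) w = a := by
    have h₁ := ((hf.differentiable two_ne_zero (v + s • w)).hasFDerivAt).comp_hasDerivAt s (hline s)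
    have h₂ : HasDerivAt (fun t : ℝ => f v + t • a) a s := by
      simpa using ((hasDerivAt_id s).smul_const a).const_add (f v)
    exact h₁.unique (h₂.congr_of_eventuallyEq (Filter.Eventually.of_forall h))
  have hd : Differentiable ℝ (fderiv ℝ f) :=
    (hf.fderiv_right (m := 1) (by norm_num)).differentiable one_ne_zero
  have h₁ := (hd (v + (0 : ℝ) • w)).hasFDerivAt.comp_hasDerivAt (0 : ℝ) (hline 0)
  have h₂ := h₁.clm_apply (hasDerivAt_const (0 : ℝ) w)
  have h₃ : HasDerivAt (fun s : ℝ => fderiv ℝ f (v + s • w) w) 0 0 := by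
    simpa only [hfirst] using hasDerivAt_const (0 : ℝ) a
  simpa using h₂.unique h₃

/-- Symmetric product computation in the proof of Theorem 3 for the
source-seeking input `b₁(q) = (k·ρ(x,y), 0)`, with `B₁ = M⁻¹ G b₁`. -/
theorem stmt14
    (ρ : ℝ × ℝ → ℝ) (hρ : ContDiff ℝ 1 ρ)
    (k m₁₁ m₂₂ m₃₃ d₁₁ d₂₂ d₃₃ : ℝ)
    (hk : 0 < k) (hm₁₁ : 0 < m₁₁) (hm₂₂ : 0 < m₂₂) (hm₃₃ : 0 < m₃₃)
    (hd₁₁ : 0 < d₁₁) (hd₂₂ : 0 < d₂₂) (hd₃₃ : 0 < d₃₃)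
    (B₀ : Fin 3 → ℝ)
    (M D : Matrix (Fin 3) (Fin 3) ℝ)
    (hM : M = Matrix.diagonal ![m₁₁, m₂₂, m₃₃])
    (hD : D = Matrix.diagonal ![d₁₁, d₂₂, d₃₃])
    (C : (Fin 3 → ℝ) → Matrix (Fin 3) (Fin 3) ℝ)
    (hC : ∀ v, C v = !![0, 0, -(m₂₂ * v 1);
                        0, 0, m₁₁ * v 0;
                        m₂₂ * v 1, -(m₁₁ * v 0), 0])
    (f₂ : (Fin 3 → ℝ) → (Fin 3 → ℝ))
    (hf₂ : f₂ = fun v => -(M⁻¹ *ᵥ (C v *ᵥ v + D *ᵥ v - B₀)))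
    (B₁ : (Fin 3 → ℝ) → (Fin 3 → ℝ))
    (hB₁ : B₁ = fun q => ![(k / m₁₁) * ρ (q 0, q 1), 0, 0]) :
    -- (a) the second-derivative term vanishes on (B₁(q), B₁(q))
    (∀ (v q : Fin 3 → ℝ), fderiv ℝ (fderiv ℝ f₂) v (B₁ q) (B₁ q) = 0) ∧
    -- (b) the symmetric product ⟨B₁ : B₁⟩
    (∀ (q v : Fin 3 → ℝ),
      fderiv ℝ B₁ q (Jmat q *ᵥ B₁ q) + fderiv ℝ B₁ q (Jmat q *ᵥ B₁ q)
          - fderiv ℝ (fderiv ℝ f₂) v (B₁ q) (B₁ q)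
        = (2 * (k / m₁₁) ^ 2 * ρ (q 0, q 1) *
            (fderiv ℝ ρ (q 0, q 1) (1, 0) * Real.cos (q 2)
              + fderiv ℝ ρ (q 0, q 1) (0, 1) * Real.sin (q 2))) •
            (![1, 0, 0] : Fin 3 → ℝ)) := by
  have hf₂_smooth : ContDiff ℝ 2 f₂ := by
    rw [contDiff_pi]
    intro i
    simp only [hf₂, hC, hD, Matrix.mulVec, dotProduct, Fin.sum_univ_three, Pi.neg_apply,
      Pi.sub_apply, Pi.add_apply, Matrix.of_apply, Matrix.cons_val]
    fun_prop
  have hsecond (v q : Fin 3 → ℝ) : fderiv ℝ (fderiv ℝ f₂) v (B₁ q) (B₁ q) = 0 := by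
    set b := (k / m₁₁) * ρ (q 0, q 1) with hb
    have hBq : B₁ q = ![b, 0, 0] := by rw [hB₁]
    refine fderiv_fderiv_apply_self_eq_zero_of_affine hf₂_smooth
      (a := -(M⁻¹ *ᵥ ![d₁₁ * b, m₁₁ * b * v 2, m₂₂ * v 1 * b - m₁₁ * b * v 1])) fun t => ?_
    rw [hBq]
    simp only [hf₂]
    rw [smul_neg, ← Matrix.mulVec_smul, ← neg_add, ← Matrix.mulVec_add]
    congr 2
    ext i
    fin_cases i <;>
      simp [hC, hD, Matrix.vecHead, Matrix.vecTail, Matrix.mulVec,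
        dotProduct, Fin.sum_univ_three, Matrix.diagonal_apply] <;> ring
  refine ⟨hsecond, fun q v => ?_⟩
  have hproj : HasFDerivAt (fun q : Fin 3 → ℝ => (q 0, q 1))
      ((ContinuousLinearMap.proj (R := ℝ) (φ := fun _ : Fin 3 => ℝ) 0).prod
        (ContinuousLinearMap.proj (R := ℝ) (φ := fun _ : Fin 3 => ℝ) 1)) q :=
    (hasFDerivAt_apply 0 q).prodMk (hasFDerivAt_apply 1 q)
  have hρq := ((hρ.differentiable one_ne_zero (q 0, q 1)).hasFDerivAt.comp q hproj).const_mul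
    (k / m₁₁)
  have hB := hρq.smul_const (![1, 0, 0] : Fin 3 → ℝ)
  have hB₁_smul : B₁ = fun x => (k / m₁₁ * (ρ ∘ fun q : Fin 3 → ℝ => (q 0, q 1)) x) •
      (![1, 0, 0] : Fin 3 → ℝ) := by
    rw [hB₁]
    ext x i
    fin_cases i <;> simp
  rw [← hB₁_smul] at hB
  have hsplit (x y : ℝ) : fderiv ℝ ρ (q 0, q 1) (x, y)
      = x * fderiv ℝ ρ (q 0, q 1) (1, 0) + y * fderiv ℝ ρ (q 0, q 1) (0, 1) := by
    rw [← smul_eq_mul, ← smul_eq_mul, ← map_smul, ← map_smul, ← map_add]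
    simp
  rw [hsecond, hB.fderiv, sub_zero]
  ext i
  fin_cases i
  · simp [hB₁, Jmat, hsplit (Real.cos _)]
    ring
  all_goals simp
end

section
/- Let T > 0 and let w₁, w₂ : ℝ → ℝ be continuous T-periodic functions satisfying ∫₀^T w_i(s) ds = 0 and ∫₀^T ∫₀^{s} w_i(r) dr ds = 0 for i = 1, 2. Define W_i(s) := ∫₀^s w_i(r) dr and Λ₁₂ := (1/(2T))·∫₀^T W₁(s)·W₂(s) ds. Then (1/T)·∫₀^T [ ∫₀^τ ∫₀^{s₁} w₁(s₁)·w₂(s₂) ds₂ ds₁ + ∫₀^τ ∫₀^{s₁} w₂(s₁)·w₁(s₂) ds₂ ds₁ ] dτ = 2·Λ₁₂, and moreover (1/T)·∫₀^T W_i(τ) dτ = 0 for i = 1, 2. -/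
/-- The symmetrized iterated integral of two continuous functions is the product of their
integrals. -/
theorem integral_integral_mul_add_swap {f g : ℝ → ℝ} (hf : Continuous f) (hg : Continuous g)
    (a t : ℝ) :
    (∫ x in a..t, ∫ y in a..x, f x * g y) + (∫ x in a..t, ∫ y in a..x, g x * f y)
      = (∫ x in a..t, f x) * ∫ x in a..t, g x := by
  have parts := intervalIntegral.integral_mul_deriv_eq_deriv_mul (a := a) (b := t)
    (u := fun x => ∫ y in a..x, f y) (v := fun x => ∫ y in a..x, g y)
    (fun x _ => hf.integral_hasStrictDerivAt a x |>.hasDerivAt)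
    (fun x _ => hg.integral_hasStrictDerivAt a x |>.hasDerivAt)
    (hf.intervalIntegrable a t) (hg.intervalIntegrable a t)
  simp only [intervalIntegral.integral_same, zero_mul, sub_zero] at parts
  simp only [intervalIntegral.integral_const_mul]
  simp only [mul_comm (g _)]
  linarith

/-- Averaging computation in the proof of Theorem 2: the average of the
symmetrized iterated integrals of the dither signals equals `2·Λ₁₂`, and the
averages of the integrated dithers vanish. -/
theorem stmt17
    (T : ℝ) (hT : 0 < T)
    (w₁ w₂ : ℝ → ℝ) (hw₁ : Continuous w₁) (hw₂ : Continuous w₂)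
    (hper₁ : Function.Periodic w₁ T) (hper₂ : Function.Periodic w₂ T)
    (hz₁ : (∫ s in (0 : ℝ)..T, w₁ s) = 0)
    (hz₂ : (∫ s in (0 : ℝ)..T, w₂ s) = 0)
    (hzz₁ : (∫ s in (0 : ℝ)..T, ∫ r in (0 : ℝ)..s, w₁ r) = 0)
    (hzz₂ : (∫ s in (0 : ℝ)..T, ∫ r in (0 : ℝ)..s, w₂ r) = 0)
    (W₁ W₂ : ℝ → ℝ)
    (hW₁ : ∀ s, W₁ s = ∫ r in (0 : ℝ)..s, w₁ r)
    (hW₂ : ∀ s, W₂ s = ∫ r in (0 : ℝ)..s, w₂ r)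
    (Λ₁₂ : ℝ)
    (hΛ : Λ₁₂ = (1 / (2 * T)) * ∫ s in (0 : ℝ)..T, W₁ s * W₂ s) :
    ((1 / T) * (∫ τ in (0 : ℝ)..T,
        ((∫ s₁ in (0 : ℝ)..τ, ∫ s₂ in (0 : ℝ)..s₁, w₁ s₁ * w₂ s₂)
          + ∫ s₁ in (0 : ℝ)..τ, ∫ s₂ in (0 : ℝ)..s₁, w₂ s₁ * w₁ s₂))
      = 2 * Λ₁₂) ∧
    ((1 / T) * (∫ τ in (0 : ℝ)..T, W₁ τ) = 0) ∧
    ((1 / T) * (∫ τ in (0 : ℝ)..T, W₂ τ) = 0) := by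
  refine ⟨?_, by simp only [hW₁, hzz₁, mul_zero], by simp only [hW₂, hzz₂, mul_zero]⟩
  simp only [integral_integral_mul_add_swap hw₁ hw₂, hΛ, hW₁, hW₂]
  field_simp
end

section
/- Let M = diag(m₁₁,m₂₂,m₃₃) and D = diag(d₁₁,d₂₂,d₃₃) be diagonal 3×3 real matrices with positive diagonal entries, let G be the 3×2 matrix with rows (1,0),(0,0),(0,1), and let C : ℝ³ → Matrix (Fin 3) (Fin 3) ℝ be a linear map such that C(v) is skew-symmetric for every v ∈ ℝ³ (so the components of C(v)v are homogeneous polynomials of degree 2 in v) and such that C((0,0,ω))·(0,0,ω) = 0 for all ω ∈ ℝ. Then there exists ĉ > 0 such that for every c ∈ (0, ĉ), setting u* := (0,c) ∈ ℝ² and v* := (0,0,c/d₃₃) ∈ ℝ³ (which satisfy C(v*)v* + Dv* = Gu*), the system M v̇ + C(v)v + Dv = Gu is shifted passive: for all v ∈ ℝ³ and u ∈ ℝ², (v − v*)ᵀ (G u − C(v)v − D v) ≤ (Gᵀv − Gᵀv*)ᵀ (u − u*). -/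
open Matrix

/-- A binary quadratic form with coefficients `a`, `s`, `q`, scaled by a small `k`, is dominated by
a positive diagonal form. -/
theorem neg_smul_quadratic_le {a s q k d₁ d₂ : ℝ} (hk : 0 ≤ k)
    (h₁ : k * (|a| + |s| + |q|) ≤ d₁) (h₂ : k * (|a| + |s| + |q|) ≤ d₂) (x y : ℝ) :
    -(k * (a * x ^ 2 + s * (x * y) + q * y ^ 2)) ≤ d₁ * x ^ 2 + d₂ * y ^ 2 := by
  have hform : -(a * x ^ 2 + s * (x * y) + q * y ^ 2) ≤ (|a| + |s| + |q|) * (x ^ 2 + y ^ 2) := by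
    have hx := sq_nonneg x
    have hy := sq_nonneg y
    have ha := mul_le_mul_of_nonneg_right (neg_abs_le a) hx
    have hq := mul_le_mul_of_nonneg_right (neg_abs_le q) hy
    have hxy : |x * y| ≤ x ^ 2 + y ^ 2 := by
      rw [abs_le]
      constructor <;> nlinarith [sq_nonneg (x + y), sq_nonneg (x - y)]
    have hs : -(s * (x * y)) ≤ |s| * (x ^ 2 + y ^ 2) :=
      (neg_le_abs _).trans (by rw [abs_mul]; gcongr)
    have hay := mul_nonneg (abs_nonneg a) hy
    have hqx := mul_nonneg (abs_nonneg q) hx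
    linarith
  calc -(k * (a * x ^ 2 + s * (x * y) + q * y ^ 2))
      = k * -(a * x ^ 2 + s * (x * y) + q * y ^ 2) := by ring
    _ ≤ k * ((|a| + |s| + |q|) * (x ^ 2 + y ^ 2)) := by gcongr
    _ = k * (|a| + |s| + |q|) * x ^ 2 + k * (|a| + |s| + |q|) * y ^ 2 := by ring
    _ ≤ d₁ * x ^ 2 + d₂ * y ^ 2 := by gcongr

/-- The quadratic form of a real skew-symmetric matrix vanishes. -/
theorem dotProduct_mulVec_self_of_transpose_eq_neg {n : Type*} [Fintype n] {A : Matrix n n ℝ}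
    (hA : Aᵀ = -A) (w : n → ℝ) : w ⬝ᵥ A *ᵥ w = 0 := by
  have h : w ⬝ᵥ A *ᵥ w = -(w ⬝ᵥ A *ᵥ w) := by
    conv_lhs => rw [dotProduct_mulVec, ← mulVec_transpose, hA, neg_mulVec, neg_dotProduct,
      dotProduct_comm]
  linarith

/-- Proposition 1: shifted passivity of planar underactuated vehicles under a
small constant yaw torque. -/
theorem stmt19
    (m₁₁ m₂₂ m₃₃ d₁₁ d₂₂ d₃₃ : ℝ)
    (hm₁₁ : 0 < m₁₁) (hm₂₂ : 0 < m₂₂) (hm₃₃ : 0 < m₃₃)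
    (hd₁₁ : 0 < d₁₁) (hd₂₂ : 0 < d₂₂) (hd₃₃ : 0 < d₃₃)
    (M D : Matrix (Fin 3) (Fin 3) ℝ)
    (hM : M = Matrix.diagonal ![m₁₁, m₂₂, m₃₃])
    (hD : D = Matrix.diagonal ![d₁₁, d₂₂, d₃₃])
    (G : Matrix (Fin 3) (Fin 2) ℝ)
    (hG : G = !![1, 0; 0, 0; 0, 1])
    (C : (Fin 3 → ℝ) →ₗ[ℝ] Matrix (Fin 3) (Fin 3) ℝ)
    (hskew : ∀ v : Fin 3 → ℝ, (C v)ᵀ = -(C v))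
    (haxis : ∀ ω : ℝ, C ![0, 0, ω] *ᵥ ![0, 0, ω] = 0) :
    ∃ chat > (0 : ℝ), ∀ c : ℝ, 0 < c → c < chat →
      -- with u* = (0,c) and v* = (0,0,c/d₃₃), which satisfy C(v*)v* + Dv* = Gu*,
      (C ![0, 0, c / d₃₃] *ᵥ ![0, 0, c / d₃₃] + D *ᵥ ![0, 0, c / d₃₃]
          = G *ᵥ ![0, c]) ∧
      -- the system is shifted passive
      ∀ (v : Fin 3 → ℝ) (u : Fin 2 → ℝ),
        (v - ![0, 0, c / d₃₃]) ⬝ᵥ (G *ᵥ u - C v *ᵥ v - D *ᵥ v)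
          ≤ (Gᵀ *ᵥ v - Gᵀ *ᵥ ![0, 0, c / d₃₃]) ⬝ᵥ (u - ![0, c]) := by
  set a := C ![1, 0, 0] 0 2
  set b := C ![1, 0, 0] 1 2
  set p := C ![0, 1, 0] 0 2
  set q := C ![0, 1, 0] 1 2
  set K := |a| + |b + p| + |q|
  have hK : 0 ≤ K := by positivity
  have hd : 0 < min d₁₁ d₂₂ := lt_min hd₁₁ hd₂₂
  refine ⟨d₃₃ * (min d₁₁ d₂₂ / (K + 1)), by positivity, fun c hc hc' => ?_⟩
  set k := c / d₃₃
  have hk : 0 < k := by positivity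
  have hck : c = d₃₃ * k := by simp only [k]; field_simp
  have hkK : k * K ≤ min d₁₁ d₂₂ := by
    have h : k < min d₁₁ d₂₂ / (K + 1) := (div_lt_iff₀' hd₃₃).2 hc'
    rw [lt_div_iff₀ (by positivity)] at h
    linarith
  have heq : D *ᵥ ![0, 0, k] = G *ᵥ ![0, c] := by
    rw [hck, hD, hG]
    ext i
    fin_cases i <;> simp [mulVec, dotProduct, diagonal]
  refine ⟨by rw [haxis, heq, zero_add], fun v u => ?_⟩
  obtain ⟨w, rfl⟩ : ∃ w, v = w + ![0, 0, k] := ⟨v - ![0, 0, k], (sub_add_cancel _ _).symm⟩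
  have hCw : w ⬝ᵥ C w *ᵥ ![0, 0, k]
      = k * (a * w 0 ^ 2 + (b + p) * (w 0 * w 1) + q * w 1 ^ 2) := by
    have hw : w = w 0 • ![1, 0, 0] + w 1 • ![0, 1, 0] + ![0, 0, w 2] := by
      ext i
      fin_cases i <;> simp
    have hcol (i : Fin 3) : C ![0, 0, w 2] i 2 = 0 := by
      have h1 : ![0, 0, w 2] = w 2 • ![0, 0, (1 : ℝ)] := by simp
      have h2 := congrFun (haxis 1) i
      rw [h1, map_smul]
      have h3 : C ![0, 0, 1] i 2 = 0 := by
        simpa [mulVec, dotProduct, Fin.sum_univ_three] using h2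
      simp [h3]
    have hrow : C w 2 2 = 0 := by
      have h := congrFun (congrFun (hskew w) 2) 2
      simp only [transpose_apply, Matrix.neg_apply] at h
      linarith
    have hentry (i : Fin 3) :
        C w i 2 = w 0 * C ![1, 0, 0] i 2 + w 1 * C ![0, 1, 0] i 2 := by
      conv_lhs => rw [hw]
      simp only [map_add, map_smul, Matrix.add_apply, Matrix.smul_apply, smul_eq_mul, hcol,
        add_zero]
    simp [mulVec, dotProduct, Fin.sum_univ_three, hrow, hentry 0, hentry 1, a, b, p, q]
    ring
  have hC : w ⬝ᵥ C (w + ![0, 0, k]) *ᵥ (w + ![0, 0, k]) = w ⬝ᵥ C w *ᵥ ![0, 0, k] := by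
    rw [mulVec_add, dotProduct_add, dotProduct_mulVec_self_of_transpose_eq_neg (hskew _),
      map_add, add_mulVec, haxis, add_zero, zero_add]
  have hGt : (Gᵀ *ᵥ w) ⬝ᵥ (u - ![0, c]) = w ⬝ᵥ G *ᵥ u - w ⬝ᵥ G *ᵥ ![0, c] := by
    rw [mulVec_transpose, ← dotProduct_mulVec, mulVec_sub, dotProduct_sub]
  have hDw : w ⬝ᵥ D *ᵥ w = d₁₁ * w 0 ^ 2 + d₂₂ * w 1 ^ 2 + d₃₃ * w 2 ^ 2 := by
    rw [hD]
    simp [mulVec_diagonal, dotProduct, Fin.sum_univ_three]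
    ring
  have hbound := neg_smul_quadratic_le hk.le (hkK.trans (min_le_left _ _))
    (hkK.trans (min_le_right _ _)) (w 0) (w 1)
  have h3 : 0 ≤ d₃₃ * w 2 ^ 2 := by positivity
  rw [mulVec_add Gᵀ, add_sub_cancel_right, add_sub_cancel_right, hGt, dotProduct_sub,
    dotProduct_sub, hC, hCw, mulVec_add D, heq, dotProduct_add, hDw]
  linarith
end
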